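/- For every positive integer n with n ≠ 4 there exists a prime number p in the interval [6n, 7n], i.e., with 6n ≤ p ≤ 7n. -/

import Mathlib

open Real Finset Chebyshev
open ArithmeticFunction hiding log
open scoped Nat

/-! ### Small cases -/

/-- Checks that the primes in the list cover all `n` with `a ≤ n ≤ b`. -/
def coverCheck (b : ℕ) : ℕ → List ℕ → Bool
  | a, [] => decide (b < a)
  | a, p :: l => decide (p ≤ 7 * a) && coverCheck b (p / 6 + 1) l

theorem cover_of_check (b n : ℕ) (hnb : n ≤ b) : ∀ (l : List ℕ) (a : ℕ),
    coverCheck b a l = true → a ≤ n → ∃ p ∈ l, 6 * n ≤ p ∧ p ≤ 7 * n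
  | [], a, h, han => by
    simp [coverCheck] at h; omega
  | p :: l, a, h, han => by
    simp only [coverCheck, Bool.and_eq_true, decide_eq_true_eq] at h
    by_cases hp : 6 * n ≤ p
    · exact ⟨p, by simp, hp, by omega⟩
    · obtain ⟨q, hq, h1⟩ := cover_of_check b n hnb l (p / 6 + 1) h.2 (by omega)
      exact ⟨q, by simp [hq], h1⟩

def coverList : List ℕ :=
  [31, 41, 47, 53, 61, 73, 89, 103, 113, 131, 151, 181, 211, 251, 293, 337, 397, 467, 541, 631,
   739, 863, 997, 1163, 1327, 1553, 1811, 2113, 2467, 2879, 3359, 3919, 4567, 5333, 6221, 7253,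
   8461, 9871, 11519, 13421, 15649, 18257, 21283, 24821, 28949, 33773, 39397, 45959, 53617,
   62549, 72973, 85133, 99317, 115861, 135173, 157679, 183959, 214607, 250361, 292081, 340757,
   397549, 463807, 541097, 631273, 736471, 859213, 1002403, 1169473, 1364381, 1591753, 1857049,
   2166557, 2527643]

theorem coverList_prime : ∀ p ∈ coverList, p.Prime := by
  simp only [coverList, List.forall_mem_cons]
  norm_num

theorem small_case (n : ℕ) (hn : 0 < n) (hn4 : n ≠ 4) (hb : n ≤ 390700) :
    ∃ p : ℕ, p.Prime ∧ 6 * n ≤ p ∧ p ≤ 7 * n := by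
  by_cases h5 : 5 ≤ n
  · obtain ⟨p, hp, h⟩ := cover_of_check 390700 n hb coverList 5 (by decide +kernel) h5
    exact ⟨p, coverList_prime p hp, h⟩
  · have : n = 1 ∨ n = 2 ∨ n = 3 := by omega
    rcases this with rfl | rfl | rfl
    · exact ⟨7, by norm_num⟩
    · exact ⟨13, by norm_num⟩
    · exact ⟨19, by norm_num⟩

/-! ### The step function -/

def stepF (m : ℕ) : ℤ :=
  ((m / 6 : ℕ) : ℤ) - ((m / 7 : ℕ) : ℤ) - ((m / 12 : ℕ) : ℤ) + ((m / 14 : ℕ) : ℤ) - ((m / 18 :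
    ℕ) : ℤ) + ((m / 21 : ℕ) : ℤ) - ((m / 30 : ℕ) : ℤ) + ((m / 35 : ℕ) : ℤ) + ((m / 36 : ℕ) : ℤ)
    - 2 * ((m / 42 : ℕ) : ℤ) + ((m / 60 : ℕ) : ℤ) - ((m / 70 : ℕ) : ℤ) + ((m / 84 : ℕ) : ℤ) +
    ((m / 90 : ℕ) : ℤ) - 2 * ((m / 105 : ℕ) : ℤ) + 2 * ((m / 126 : ℕ) : ℤ) - 2 * ((m / 180 : ℕ)
    : ℤ) + 2 * ((m / 210 : ℕ) : ℤ) - 2 * ((m / 252 : ℕ) : ℤ) + 2 * ((m / 315 : ℕ) : ℤ) - 2 * ((m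
    / 630 : ℕ) : ℤ) + 6 * ((m / 1260 : ℕ) : ℤ)

theorem stepF_add (m : ℕ) : stepF (m + 1260) = stepF m := by
  have h6 : (m + 1260) / 6 = m / 6 + 210 := by omega
  have h7 : (m + 1260) / 7 = m / 7 + 180 := by omega
  have h12 : (m + 1260) / 12 = m / 12 + 105 := by omega
  have h14 : (m + 1260) / 14 = m / 14 + 90 := by omega
  have h18 : (m + 1260) / 18 = m / 18 + 70 := by omega
  have h21 : (m + 1260) / 21 = m / 21 + 60 := by omega
  have h30 : (m + 1260) / 30 = m / 30 + 42 := by omega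
  have h35 : (m + 1260) / 35 = m / 35 + 36 := by omega
  have h36 : (m + 1260) / 36 = m / 36 + 35 := by omega
  have h42 : (m + 1260) / 42 = m / 42 + 30 := by omega
  have h60 : (m + 1260) / 60 = m / 60 + 21 := by omega
  have h70 : (m + 1260) / 70 = m / 70 + 18 := by omega
  have h84 : (m + 1260) / 84 = m / 84 + 15 := by omega
  have h90 : (m + 1260) / 90 = m / 90 + 14 := by omega
  have h105 : (m + 1260) / 105 = m / 105 + 12 := by omega
  have h126 : (m + 1260) / 126 = m / 126 + 10 := by omega
  have h180 : (m + 1260) / 180 = m / 180 + 7 := by omega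
  have h210 : (m + 1260) / 210 = m / 210 + 6 := by omega
  have h252 : (m + 1260) / 252 = m / 252 + 5 := by omega
  have h315 : (m + 1260) / 315 = m / 315 + 4 := by omega
  have h630 : (m + 1260) / 630 = m / 630 + 2 := by omega
  have h1260 : (m + 1260) / 1260 = m / 1260 + 1 := by omega
  simp only [stepF, h6, h7, h12, h14, h18, h21, h30, h35, h36, h42, h60, h70, h84, h90, h105, h126, h180, h210,
    h252, h315, h630, h1260]
  push_cast
  ring

theorem stepF_small : ∀ m < 1266, stepF m ≤ if m = 6 then 1 else 0 := by
  decide +kernel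

theorem stepF_le_one (m : ℕ) : stepF m ≤ 1 := by
  induction m using Nat.strong_induction_on with
  | _ m ih =>
    by_cases h : m < 1266
    · have := stepF_small m h
      split_ifs at this <;> omega
    · obtain ⟨k, rfl⟩ : ∃ k, m = k + 1260 := ⟨m - 1260, by omega⟩
      rw [stepF_add]
      exact ih k (by omega)

theorem stepF_le (m : ℕ) :
    stepF m ≤ (if m = 6 then 1 else 0) + (if 1266 ≤ m then 1 else 0) := by
  by_cases h : m < 1266
  · have := stepF_small m h
    rw [if_neg (by omega : ¬ 1266 ≤ m)]
    simpa using this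
  · rw [if_pos (by omega : 1266 ≤ m), if_neg (by omega : m ≠ 6)]
    simpa using stepF_le_one m

/-! ### Factorials -/

theorem log_factorial_eq (M : ℕ) : ∀ N ≤ M,
    log (N ! : ℝ) = ∑ k ∈ Ioc 0 M, vonMangoldt k * ((N / k : ℕ) : ℝ) := by
  intro N
  induction N with
  | zero => intro _; simp
  | succ N ih =>
    intro h
    rw [Nat.factorial_succ, Nat.cast_mul, Real.log_mul (by positivity) (by positivity),
      ih (by omega), ← vonMangoldt_sum]
    have h1 : (N + 1).divisors = (Ioc 0 M).filter (fun k => k ∣ N + 1) := by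
      ext k
      simp only [Nat.mem_divisors, mem_filter, mem_Ioc]
      constructor
      · rintro ⟨hk, -⟩
        exact ⟨⟨Nat.pos_of_dvd_of_pos hk (by omega), (Nat.le_of_dvd (by omega) hk).trans h⟩, hk⟩
      · rintro ⟨-, hk⟩
        exact ⟨hk, by omega⟩
    rw [h1, sum_filter, ← sum_add_distrib]
    refine sum_congr rfl fun k _ => ?_
    rw [Nat.succ_div]
    split_ifs
    · push_cast; ring
    · simp

theorem log_factorial_lower (m : ℕ) : m * log (m + 1) - m ≤ log (m ! : ℝ) := by
  induction m with
  | zero => simp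
  | succ m ih =>
    rw [Nat.factorial_succ, Nat.cast_mul, Real.log_mul (by positivity) (by positivity)]
    push_cast
    have h0 : (0 : ℝ) < m + 1 := by positivity
    have h := log_le_sub_one_of_pos (x := ((m : ℝ) + 1 + 1) / (m + 1)) (by positivity)
    rw [Real.log_div (by positivity) (by positivity)] at h
    have h2 : ((m : ℝ) + 1) * (((m : ℝ) + 1 + 1) / (m + 1) - 1) = 1 := by field_simp; ring
    have h3 := mul_le_mul_of_nonneg_left h h0.le
    rw [h2] at h3
    nlinarith

theorem log_factorial_upper (m : ℕ) (hm : 1 ≤ m) :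
    log (m ! : ℝ) ≤ (m + 1) * log m - m + 1 := by
  induction m, hm using Nat.le_induction with
  | base => simp
  | succ m hm ih =>
    rw [Nat.factorial_succ, Nat.cast_mul, Real.log_mul (by positivity) (by positivity)]
    push_cast
    have h0 : (0 : ℝ) < m + 1 := by positivity
    have hm0 : (0 : ℝ) < m := by exact_mod_cast hm
    have h := log_le_sub_one_of_pos (x := (m : ℝ) / (m + 1)) (by positivity)
    rw [Real.log_div (by positivity) (by positivity)] at h
    have h2 : ((m : ℝ) + 1) * ((m : ℝ) / (m + 1) - 1) = -1 := by field_simp; ring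
    have h3 := mul_le_mul_of_nonneg_left h h0.le
    rw [h2] at h3
    nlinarith

theorem log_factorial_near (N e : ℕ) (he : 1 ≤ e) (heN : e ≤ N) :
    |log ((N / e)! : ℝ) - (N : ℝ) / e * (log N - log e - 1)| ≤ log N + 1 := by
  have he0 : (0 : ℝ) < e := by exact_mod_cast he
  have hN0 : (0 : ℝ) < N := by exact_mod_cast (by omega : 0 < N)
  have hm1 : 1 ≤ N / e := (Nat.one_le_div_iff he).2 heN
  set m := N / e with hm
  have hm0 : (1 : ℝ) ≤ m := by exact_mod_cast hm1
  rw [← Real.log_div hN0.ne' he0.ne']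
  set t : ℝ := (N : ℝ) / e with ht
  have hmt : (m : ℝ) ≤ t := Nat.cast_div_le
  have htm : t ≤ m + 1 := by
    rw [ht, div_le_iff₀ he0]
    have := Nat.lt_mul_div_succ N he
    have h2 : (N : ℝ) ≤ (e * (N / e + 1) : ℕ) := by exact_mod_cast this.le
    push_cast at h2
    rw [← hm] at h2
    linarith
  have htN : t ≤ N := div_le_self hN0.le (by exact_mod_cast he)
  have ht1 : 1 ≤ t := hm0.trans hmt
  have hlt : 0 ≤ log t := log_nonneg ht1
  have hltN : log t ≤ log N := log_le_log (by linarith) htN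
  have hlo := log_factorial_lower m
  have hup := log_factorial_upper m hm1
  have h1 : log t ≤ log ((m : ℝ) + 1) := log_le_log (by linarith) htm
  have h2 : log (m : ℝ) ≤ log t := log_le_log (by linarith) hmt
  have h2' : 0 ≤ log (m : ℝ) := log_nonneg hm0
  have h3 : (m : ℝ) * log t ≤ m * log ((m : ℝ) + 1) := by gcongr
  have h4 : (t - 1) * log t ≤ m * log t := by gcongr; linarith
  have h5 : (m : ℝ) * log m - m ≤ t * log t - t := by
    have h := log_le_sub_one_of_pos (x := (m : ℝ) / t) (by positivity)
    have h' := log_le_sub_one_of_pos (x := t / (m : ℝ)) (by positivity)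
    rw [Real.log_div (by positivity) (by positivity)] at h
    have h6 : t * ((m : ℝ) / t - 1) = m - t := by field_simp
    have h7 := mul_le_mul_of_nonneg_left h (by linarith : 0 ≤ t)
    rw [h6] at h7
    nlinarith
  rw [abs_le]
  constructor <;> nlinarith

/-- The combination of logarithms of factorials. -/
noncomputable def comb (N : ℕ) : ℝ :=
  log ((N / 6)! : ℝ) - log ((N / 7)! : ℝ) - log ((N / 12)! : ℝ) + log ((N / 14)! : ℝ) - log
    ((N / 18)! : ℝ) + log ((N / 21)! : ℝ) - log ((N / 30)! : ℝ) + log ((N / 35)! : ℝ) + log ((N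
    / 36)! : ℝ) - 2 * log ((N / 42)! : ℝ) + log ((N / 60)! : ℝ) - log ((N / 70)! : ℝ) + log ((N
    / 84)! : ℝ) + log ((N / 90)! : ℝ) - 2 * log ((N / 105)! : ℝ) + 2 * log ((N / 126)! : ℝ) - 2
    * log ((N / 180)! : ℝ) + 2 * log ((N / 210)! : ℝ) - 2 * log ((N / 252)! : ℝ) + 2 * log ((N /
    315)! : ℝ) - 2 * log ((N / 630)! : ℝ) + 6 * log ((N / 1260)! : ℝ)

theorem comb_eq (N : ℕ) :
    comb N = ∑ k ∈ Ioc 0 N, vonMangoldt k * (stepF (N / k) : ℝ) := by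
  have h : ∀ e, log ((N / e)! : ℝ) =
      ∑ k ∈ Ioc 0 N, vonMangoldt k * ((N / k / e : ℕ) : ℝ) := by
    intro e
    rw [log_factorial_eq N (N / e) (Nat.div_le_self _ _)]
    refine sum_congr rfl fun k _ => ?_
    rw [Nat.div_right_comm]
  simp only [comb, h, mul_sum, ← sum_add_distrib, ← sum_sub_distrib]
  refine sum_congr rfl fun k _ => ?_
  simp only [stepF, Int.cast_add, Int.cast_sub, Int.cast_mul, Int.cast_natCast, Int.cast_ofNat]
  ring

theorem const_bound : (0.0059 : ℝ) ≤
    -(4 / 105) * log 2 - 19 / 420 * log 3 + 1 / 252 * log 5 + 7 / 180 * log 7 := by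
  have h2 := log_two_lt_d9
  have h3 := log_three_lt_d9
  have h2' := log_two_gt_d9
  have h3' := log_three_gt_d9
  have h5 : 6 * log 2 + 5 * log 3 ≤ 6 * log 5 := by
    have : log ((2 : ℝ) ^ 6 * 3 ^ 5) ≤ log (5 ^ 6) := log_le_log (by norm_num) (by norm_num)
    rw [Real.log_mul (by norm_num) (by norm_num), Real.log_pow, Real.log_pow, Real.log_pow] at this
    push_cast at this
    exact this
  have h7 : 5 * log 2 + log 3 + 2 * log 5 ≤ 4 * log 7 := by
    have : log ((2 : ℝ) ^ 5 * 3 * 5 ^ 2) ≤ log (7 ^ 4) := log_le_log (by norm_num) (by norm_num)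
    rw [Real.log_mul (by norm_num) (by norm_num), Real.log_mul (by norm_num) (by norm_num),
      Real.log_pow, Real.log_pow, Real.log_pow] at this
    push_cast at this
    exact this
  linarith

theorem comb_lower (N : ℕ) (hN : 1260 ≤ N) :
    0.0059 * (N : ℝ) - 35 * (log N + 1) ≤ comb N := by
  have hb := fun e h1 h2 => log_factorial_near N e h1 h2
  have b6 := abs_le.1 (hb 6 (by norm_num) (by omega))
  have b7 := abs_le.1 (hb 7 (by norm_num) (by omega))
  have b12 := abs_le.1 (hb 12 (by norm_num) (by omega))
  have b14 := abs_le.1 (hb 14 (by norm_num) (by omega))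
  have b18 := abs_le.1 (hb 18 (by norm_num) (by omega))
  have b21 := abs_le.1 (hb 21 (by norm_num) (by omega))
  have b30 := abs_le.1 (hb 30 (by norm_num) (by omega))
  have b35 := abs_le.1 (hb 35 (by norm_num) (by omega))
  have b36 := abs_le.1 (hb 36 (by norm_num) (by omega))
  have b42 := abs_le.1 (hb 42 (by norm_num) (by omega))
  have b60 := abs_le.1 (hb 60 (by norm_num) (by omega))
  have b70 := abs_le.1 (hb 70 (by norm_num) (by omega))
  have b84 := abs_le.1 (hb 84 (by norm_num) (by omega))
  have b90 := abs_le.1 (hb 90 (by norm_num) (by omega))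
  have b105 := abs_le.1 (hb 105 (by norm_num) (by omega))
  have b126 := abs_le.1 (hb 126 (by norm_num) (by omega))
  have b180 := abs_le.1 (hb 180 (by norm_num) (by omega))
  have b210 := abs_le.1 (hb 210 (by norm_num) (by omega))
  have b252 := abs_le.1 (hb 252 (by norm_num) (by omega))
  have b315 := abs_le.1 (hb 315 (by norm_num) (by omega))
  have b630 := abs_le.1 (hb 630 (by norm_num) (by omega))
  have b1260 := abs_le.1 (hb 1260 (by norm_num) (by omega))
  have l6 : log (6 : ℝ) = log 2 + log 3 := by
    rw [show (6 : ℝ) = 2 ^ 1 * 3 ^ 1 by norm_num]; simp [Real.log_mul, Real.log_pow]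
  have l12 : log (12 : ℝ) = 2 * log 2 + log 3 := by
    rw [show (12 : ℝ) = 2 ^ 2 * 3 ^ 1 by norm_num]; simp [Real.log_mul, Real.log_pow]
  have l14 : log (14 : ℝ) = log 2 + log 7 := by
    rw [show (14 : ℝ) = 2 ^ 1 * 7 ^ 1 by norm_num]; simp [Real.log_mul, Real.log_pow]
  have l18 : log (18 : ℝ) = log 2 + 2 * log 3 := by
    rw [show (18 : ℝ) = 2 ^ 1 * 3 ^ 2 by norm_num]; simp [Real.log_mul, Real.log_pow]
  have l21 : log (21 : ℝ) = log 3 + log 7 := by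
    rw [show (21 : ℝ) = 3 ^ 1 * 7 ^ 1 by norm_num]; simp [Real.log_mul, Real.log_pow]
  have l30 : log (30 : ℝ) = log 2 + log 3 + log 5 := by
    rw [show (30 : ℝ) = 2 ^ 1 * 3 ^ 1 * 5 ^ 1 by norm_num]; simp [Real.log_mul, Real.log_pow]
  have l35 : log (35 : ℝ) = log 5 + log 7 := by
    rw [show (35 : ℝ) = 5 ^ 1 * 7 ^ 1 by norm_num]; simp [Real.log_mul, Real.log_pow]
  have l36 : log (36 : ℝ) = 2 * log 2 + 2 * log 3 := by
    rw [show (36 : ℝ) = 2 ^ 2 * 3 ^ 2 by norm_num]; simp [Real.log_mul, Real.log_pow]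
  have l42 : log (42 : ℝ) = log 2 + log 3 + log 7 := by
    rw [show (42 : ℝ) = 2 ^ 1 * 3 ^ 1 * 7 ^ 1 by norm_num]; simp [Real.log_mul, Real.log_pow]
  have l60 : log (60 : ℝ) = 2 * log 2 + log 3 + log 5 := by
    rw [show (60 : ℝ) = 2 ^ 2 * 3 ^ 1 * 5 ^ 1 by norm_num]; simp [Real.log_mul, Real.log_pow]
  have l70 : log (70 : ℝ) = log 2 + log 5 + log 7 := by
    rw [show (70 : ℝ) = 2 ^ 1 * 5 ^ 1 * 7 ^ 1 by norm_num]; simp [Real.log_mul, Real.log_pow]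
  have l84 : log (84 : ℝ) = 2 * log 2 + log 3 + log 7 := by
    rw [show (84 : ℝ) = 2 ^ 2 * 3 ^ 1 * 7 ^ 1 by norm_num]; simp [Real.log_mul, Real.log_pow]
  have l90 : log (90 : ℝ) = log 2 + 2 * log 3 + log 5 := by
    rw [show (90 : ℝ) = 2 ^ 1 * 3 ^ 2 * 5 ^ 1 by norm_num]; simp [Real.log_mul, Real.log_pow]
  have l105 : log (105 : ℝ) = log 3 + log 5 + log 7 := by
    rw [show (105 : ℝ) = 3 ^ 1 * 5 ^ 1 * 7 ^ 1 by norm_num]; simp [Real.log_mul, Real.log_pow]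
  have l126 : log (126 : ℝ) = log 2 + 2 * log 3 + log 7 := by
    rw [show (126 : ℝ) = 2 ^ 1 * 3 ^ 2 * 7 ^ 1 by norm_num]; simp [Real.log_mul, Real.log_pow]
  have l180 : log (180 : ℝ) = 2 * log 2 + 2 * log 3 + log 5 := by
    rw [show (180 : ℝ) = 2 ^ 2 * 3 ^ 2 * 5 ^ 1 by norm_num]; simp [Real.log_mul, Real.log_pow]
  have l210 : log (210 : ℝ) = log 2 + log 3 + log 5 + log 7 := by
    rw [show (210 : ℝ) = 2 ^ 1 * 3 ^ 1 * 5 ^ 1 * 7 ^ 1 by norm_num]; simp [Real.log_mul, Real.log_pow]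
  have l252 : log (252 : ℝ) = 2 * log 2 + 2 * log 3 + log 7 := by
    rw [show (252 : ℝ) = 2 ^ 2 * 3 ^ 2 * 7 ^ 1 by norm_num]; simp [Real.log_mul, Real.log_pow]
  have l315 : log (315 : ℝ) = 2 * log 3 + log 5 + log 7 := by
    rw [show (315 : ℝ) = 3 ^ 2 * 5 ^ 1 * 7 ^ 1 by norm_num]; simp [Real.log_mul, Real.log_pow]
  have l630 : log (630 : ℝ) = log 2 + 2 * log 3 + log 5 + log 7 := by
    rw [show (630 : ℝ) = 2 ^ 1 * 3 ^ 2 * 5 ^ 1 * 7 ^ 1 by norm_num]; simp [Real.log_mul, Real.log_pow]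
  have l1260 : log (1260 : ℝ) = 2 * log 2 + 2 * log 3 + log 5 + log 7 := by
    rw [show (1260 : ℝ) = 2 ^ 2 * 3 ^ 2 * 5 ^ 1 * 7 ^ 1 by norm_num]; simp [Real.log_mul, Real.log_pow]
  have hc := mul_le_mul_of_nonneg_left const_bound (Nat.cast_nonneg (α := ℝ) N)
  simp only [comb]
  push_cast at *
  simp only [l6, l12, l14, l18, l21, l30, l35, l36, l42, l60, l70, l84, l90, l105, l126, l180, l210,
    l252, l315, l630, l1260] at *
  set E := log (N : ℝ) + 1 with hE
  clear_value E
  have key : ((N : ℝ) / 6 * (log N - (log 2 + log 3) - 1)) - ((N : ℝ) / 7 * (log N - (log 7) - 1)) - ((N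
      : ℝ) / 12 * (log N - (2 * log 2 + log 3) - 1)) + ((N : ℝ) / 14 * (log N - (log 2 + log 7) -
      1)) - ((N : ℝ) / 18 * (log N - (log 2 + 2 * log 3) - 1)) + ((N : ℝ) / 21 * (log N - (log 3 +
      log 7) - 1)) - ((N : ℝ) / 30 * (log N - (log 2 + log 3 + log 5) - 1)) + ((N : ℝ) / 35 * (log
      N - (log 5 + log 7) - 1)) + ((N : ℝ) / 36 * (log N - (2 * log 2 + 2 * log 3) - 1)) - 2 * ((N
      : ℝ) / 42 * (log N - (log 2 + log 3 + log 7) - 1)) + ((N : ℝ) / 60 * (log N - (2 * log 2 +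
      log 3 + log 5) - 1)) - ((N : ℝ) / 70 * (log N - (log 2 + log 5 + log 7) - 1)) + ((N : ℝ) /
      84 * (log N - (2 * log 2 + log 3 + log 7) - 1)) + ((N : ℝ) / 90 * (log N - (log 2 + 2 * log
      3 + log 5) - 1)) - 2 * ((N : ℝ) / 105 * (log N - (log 3 + log 5 + log 7) - 1)) + 2 * ((N :
      ℝ) / 126 * (log N - (log 2 + 2 * log 3 + log 7) - 1)) - 2 * ((N : ℝ) / 180 * (log N - (2 *
      log 2 + 2 * log 3 + log 5) - 1)) + 2 * ((N : ℝ) / 210 * (log N - (log 2 + log 3 + log 5 +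
      log 7) - 1)) - 2 * ((N : ℝ) / 252 * (log N - (2 * log 2 + 2 * log 3 + log 7) - 1)) + 2 * ((N
      : ℝ) / 315 * (log N - (2 * log 3 + log 5 + log 7) - 1)) - 2 * ((N : ℝ) / 630 * (log N - (log
      2 + 2 * log 3 + log 5 + log 7) - 1)) + 6 * ((N : ℝ) / 1260 * (log N - (2 * log 2 + 2 * log 3
      + log 5 + log 7) - 1)) =
      N * (-(4 / 105) * log 2 - 19 / 420 * log 3 + 1 / 252 * log 5 + 7 / 180 * log 7) := by
    ring
  linarith only [hc, key, b6.1, b7.2, b12.2, b14.1, b18.2, b21.1, b30.2, b35.1, b36.1, b42.2, b60.1, b70.2, b84.1,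
    b90.1, b105.2, b126.1, b180.2, b210.1, b252.2, b315.1, b630.2, b1260.1]

theorem comb_upper (n : ℕ)
    (hp : ∀ p : ℕ, p.Prime → 6 * n ≤ p → ¬ p ≤ 7 * n) :
    comb (42 * n) ≤ (ψ (7 * n : ℕ) - θ (7 * n : ℕ)) + ψ ((42 * n / 1266 : ℕ) : ℝ) := by
  rw [comb_eq, psi_sub_theta_eq_sum_not_prime, psi, Nat.floor_natCast, Nat.floor_natCast]
  have e1 : ∑ k ∈ Ioc 0 (7 * n) with ¬ k.Prime, vonMangoldt k =
      ∑ k ∈ Ioc 0 (42 * n), if k ≤ 7 * n ∧ ¬ k.Prime then vonMangoldt k else 0 := by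
    rw [← sum_filter]
    refine sum_congr ?_ fun _ _ => rfl
    ext k
    simp only [mem_filter, mem_Ioc]
    constructor
    · rintro ⟨⟨h1, h2⟩, h3⟩; exact ⟨⟨h1, by omega⟩, h2, h3⟩
    · rintro ⟨⟨h1, h2⟩, h3, h4⟩; exact ⟨⟨h1, h3⟩, h4⟩
  have e2 : ∑ k ∈ Ioc 0 (42 * n / 1266), vonMangoldt k =
      ∑ k ∈ Ioc 0 (42 * n), if k ≤ 42 * n / 1266 then vonMangoldt k else 0 := by
    rw [← sum_filter]
    refine sum_congr ?_ fun _ _ => rfl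
    ext k
    simp only [mem_filter, mem_Ioc]
    constructor
    · rintro ⟨h1, h2⟩; exact ⟨⟨h1, by omega⟩, h2⟩
    · rintro ⟨⟨h1, h2⟩, h3⟩; exact ⟨h1, h3⟩
  rw [e1, e2, ← sum_add_distrib]
  refine sum_le_sum fun k hk => ?_
  have hk0 : 0 < k := (mem_Ioc.1 hk).1
  have hL : 0 ≤ vonMangoldt k := vonMangoldt_nonneg
  have hF : (stepF (42 * n / k) : ℝ) ≤
      (if 42 * n / k = 6 then 1 else 0) + (if 1266 ≤ 42 * n / k then 1 else 0) := by
    exact_mod_cast stepF_le (42 * n / k)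
  refine (mul_le_mul_of_nonneg_left hF hL).trans ?_
  rw [mul_add]
  refine add_le_add ?_ ?_
  · by_cases h6 : 42 * n / k = 6
    · have h1 : 6 * k ≤ 42 * n := (Nat.le_div_iff_mul_le hk0).1 h6.ge
      have h2 : 42 * n < 7 * k := (Nat.div_lt_iff_lt_mul hk0).1 (by omega)
      have h3 : ¬ k.Prime := fun h => hp k h (by omega) (by omega)
      rw [if_pos h6, if_pos ⟨by omega, h3⟩, mul_one]
    · rw [if_neg h6, mul_zero]
      split_ifs
      · exact hL
      · exact le_rfl
  · by_cases h6 : 1266 ≤ 42 * n / k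
    · have h1 : k ≤ 42 * n / 1266 := by
        rw [Nat.le_div_iff_mul_le hk0] at h6
        rw [Nat.le_div_iff_mul_le (by norm_num)]
        linarith
      rw [if_pos h6, if_pos h1, mul_one]
    · rw [if_neg h6, mul_zero]
      split_ifs
      · exact hL
      · exact le_rfl

theorem final_numeric (u : ℝ) (hu : 25 ≤ u)
    (h : 0.0059 * (42 * u ^ 4) - 35 * (u / 5 + 12 + 1) ≤
      2 * (2.65 * u ^ 2) * (u / 5 + 10) + (1.3863 * (42 * u ^ 4 / 1266)
        + 2 * (0.2 * u ^ 2) * (u / 5 + 8))) : False := by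
  have hu0 : 0 ≤ u - 25 := by linarith
  have hu3 : 0 ≤ (u - 25) * u ^ 3 := by positivity
  have hu2 : 0 ≤ (u - 25) * u ^ 2 := by positivity
  have hu1 : 0 ≤ (u - 25) * u := mul_nonneg hu0 (by linarith)
  ring_nf at h hu1 hu2 hu3
  linarith

theorem large_case (n : ℕ) (hn : 390625 ≤ n) :
    ∃ p : ℕ, p.Prime ∧ 6 * n ≤ p ∧ p ≤ 7 * n := by
  by_contra hcon
  have hp : ∀ p : ℕ, p.Prime → 6 * n ≤ p → ¬ p ≤ 7 * n :=
    fun p h1 h2 h3 => hcon ⟨p, h1, h2, h3⟩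
  have hup := comb_upper n hp
  have hlo := comb_lower (42 * n) (by omega)
  have hnR : (390625 : ℝ) ≤ n := by exact_mod_cast hn
  have hn0 : (0 : ℝ) < n := by linarith
  have h1 := psi_sub_theta_le (x := ((7 * n : ℕ) : ℝ)) (by exact_mod_cast (by omega : 1 ≤ 7 * n))
  have hx1 : (1 : ℝ) ≤ ((42 * n / 1266 : ℕ) : ℝ) := by
    exact_mod_cast (by omega : 1 ≤ 42 * n / 1266)
  have h2 := psi_le hx1
  set x : ℝ := ((42 * n / 1266 : ℕ) : ℝ) with hx
  have hxn : x ≤ 42 * n / 1266 := by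
    have : ((42 * n / 1266 : ℕ) : ℝ) ≤ ((42 * n : ℕ) : ℝ) / ((1266 : ℕ) : ℝ) := Nat.cast_div_le
    push_cast at this
    exact this
  obtain ⟨u, hu25, hun⟩ : ∃ u : ℝ, 25 ≤ u ∧ (n : ℝ) = u ^ 4 := by
    refine ⟨√(√n), ?_, ?_⟩
    · refine Real.le_sqrt_of_sq_le (Real.le_sqrt_of_sq_le ?_)
      norm_num; linarith
    · rw [show (4 : ℕ) = 2 * 2 from rfl, pow_mul, Real.sq_sqrt (by positivity),
        Real.sq_sqrt (by positivity)]
  have hu0 : 0 < u := by linarith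
  have he := exp_one_gt_d9
  have hlogu : log u ≤ u / 20 + 2 := by
    have h := log_le_sub_one_of_pos (x := u / 20) (by positivity)
    rw [Real.log_div hu0.ne' (by norm_num)] at h
    have h20 : log (20 : ℝ) ≤ 3 := by
      rw [Real.log_le_iff_le_exp (by norm_num), show (3 : ℝ) = (3 : ℕ) * 1 by norm_num,
        Real.exp_nat_mul]
      calc (20 : ℝ) ≤ 2.7182818283 ^ 3 := by norm_num
        _ ≤ _ := by gcongr
    linarith
  have hlogn : log (n : ℝ) ≤ u / 5 + 8 := by
    rw [hun, Real.log_pow]; push_cast; linarith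
  have hlog7 : log (7 : ℝ) ≤ 2 := by
    rw [Real.log_le_iff_le_exp (by norm_num), show (2 : ℝ) = (2 : ℕ) * 1 by norm_num,
      Real.exp_nat_mul]
    calc (7 : ℝ) ≤ 2.7182818283 ^ 2 := by norm_num
      _ ≤ _ := by gcongr
  have hlog42 : log (42 : ℝ) ≤ 4 := by
    rw [Real.log_le_iff_le_exp (by norm_num), show (4 : ℝ) = (4 : ℕ) * 1 by norm_num,
      Real.exp_nat_mul]
    calc (42 : ℝ) ≤ 2.7182818283 ^ 4 := by norm_num
      _ ≤ _ := by gcongr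
  have hlog4 : log (4 : ℝ) ≤ 1.3863 := by
    rw [show (4 : ℝ) = 2 ^ 2 by norm_num, Real.log_pow]
    push_cast
    linarith [log_two_lt_d9]
  have hs7 : √((7 * n : ℕ) : ℝ) ≤ 2.65 * u ^ 2 := by
    refine Real.sqrt_le_iff.2 ⟨by positivity, ?_⟩
    push_cast; rw [hun]; nlinarith [pow_pos hu0 4]
  have hsx : √x ≤ 0.2 * u ^ 2 := by
    refine Real.sqrt_le_iff.2 ⟨by positivity, ?_⟩
    rw [hun] at hxn; nlinarith [pow_pos hu0 4]
  have hlx : log x ≤ u / 5 + 8 :=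
    (log_le_log (by linarith) (by linarith)).trans hlogn
  have hl7n : log ((7 * n : ℕ) : ℝ) ≤ u / 5 + 10 := by
    push_cast
    rw [Real.log_mul (by norm_num) hn0.ne']; linarith
  have hl42n : log ((42 * n : ℕ) : ℝ) ≤ u / 5 + 12 := by
    push_cast
    rw [Real.log_mul (by norm_num) hn0.ne']; linarith
  have h1' : 2 * √((7 * n : ℕ) : ℝ) * log ((7 * n : ℕ) : ℝ) ≤ 2 * (2.65 * u ^ 2) * (u / 5 + 10) := by
    gcongr
  have h2' : 2 * √x * log x ≤ 2 * (0.2 * u ^ 2) * (u / 5 + 8) := by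
    gcongr
  have h3' : log 4 * x ≤ 1.3863 * (42 * n / 1266) := by
    gcongr
  have hmain : 0.0059 * ((42 * n : ℕ) : ℝ) - 35 * (u / 5 + 12 + 1) ≤
      2 * (2.65 * u ^ 2) * (u / 5 + 10) + (1.3863 * (42 * n / 1266)
        + 2 * (0.2 * u ^ 2) * (u / 5 + 8)) := by
    linarith
  push_cast at hmain
  rw [hun] at hmain
  exact final_numeric u hu25 hmain

theorem exists_prime_in_Icc_six_seven (n : ℕ) (hn : 0 < n) (hn4 : n ≠ 4) :
    ∃ p : ℕ, p.Prime ∧ 6 * n ≤ p ∧ p ≤ 7 * n := by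
  by_cases h : n ≤ 390700
  · exact small_case n hn hn4 h
  · exact large_case n (by omega)
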